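/- arXiv:2211.06569 — 4 statements merged into one kernel-verified Lean document; each statement's English description precedes it below -/
import Mathlib

section
/- Let n be a positive natural number, let g₁, g₂ : Fin n → ℝ, and let f : Fin n → ℝ satisfy f(i) ≠ 0 for every i. Then (1/n) Σ_{i} 1(f(i) > 0) · (g₁(i) − g₂(i)) = (1/n) Σ_{i} max(g₁(i) − g₂(i), 0) − (1/n) Σ_{i} 1( sgn(g₁(i) − g₂(i)) · f(i) < 0 ) · |g₁(i) − g₂(i)|, where sgn(t) = 1 if t > 0, sgn(t) = −1 if t < 0, and sgn(0) = 0. That is, the empirical treatment objective equals a constant (independent of f) minus the weighted 0–1 classification loss with label sgn(g₁(i) − g₂(i)) and sample weight |g₁(i) − g₂(i)|. -/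
open Finset

/-- The gain `x` collected when the score `t` is positive equals the positive part of `x`
minus the loss `|x|` incurred when `t` disagrees in sign with `x`. -/
theorem ite_pos_mul_eq_max_sub_ite_sign_mul_abs (x : ℝ) {t : ℝ} (ht : t ≠ 0) :
    (if 0 < t then (1 : ℝ) else 0) * x
      = max x 0 - (if Real.sign x * t < 0 then (1 : ℝ) else 0) * |x| := by
  rcases lt_trichotomy x 0 with hx | rfl | hx
  · rw [Real.sign_of_neg hx, abs_of_neg hx, max_eq_right hx.le]
    simp
  · simp
  · rw [Real.sign_of_pos hx, abs_of_pos hx, max_eq_left hx.le]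
    rcases ht.lt_or_gt with h | h <;> simp [h, h.not_gt]

/-- Proposition 2 (key identity): for a nowhere-zero score function `f`, the empirical
treatment objective `(1/n) Σᵢ 1(f(i) > 0)·(g₁(i) − g₂(i))` equals a constant independent
of `f`, namely `(1/n) Σᵢ max(g₁(i) − g₂(i), 0)`, minus the weighted 0–1 classification
loss with label `sgn(g₁(i) − g₂(i))` and sample weight `|g₁(i) − g₂(i)|`. -/
theorem rise_empirical_objective_decomposition
    (n : ℕ) (hn : 0 < n) (g₁ g₂ f : Fin n → ℝ) (hf : ∀ i, f i ≠ 0) :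
    (1 / (n : ℝ)) * ∑ i, (if 0 < f i then (1 : ℝ) else 0) * (g₁ i - g₂ i)
      = (1 / (n : ℝ)) * ∑ i, max (g₁ i - g₂ i) 0
        - (1 / (n : ℝ)) * ∑ i, (if Real.sign (g₁ i - g₂ i) * f i < 0 then (1 : ℝ) else 0)
            * |g₁ i - g₂ i| := by
  rw [← mul_sub, ← Finset.sum_sub_distrib]
  congr 1
  exact Finset.sum_congr rfl fun i _ => ite_pos_mul_eq_max_sub_ite_sign_mul_abs _ (hf i)
end

section
/- Let n be a positive natural number and let g₁, g₂ : Fin n → ℝ. For real-valued score functions f, f' : Fin n → ℝ with f(i) ≠ 0 and f'(i) ≠ 0 for all i, the following are equivalent: (a) Σ_{i} 1(f(i) > 0)(g₁(i) − g₂(i)) ≥ Σ_{i} 1(f'(i) > 0)(g₁(i) − g₂(i)); (b) Σ_{i} 1(sgn(g₁(i) − g₂(i)) · f(i) < 0)|g₁(i) − g₂(i)| ≤ Σ_{i} 1(sgn(g₁(i) − g₂(i)) · f'(i) < 0)|g₁(i) − g₂(i)|. Consequently, among nowhere-zero score functions, f maximizes the empirical objective Σᵢ 1(sgn(f(i)) =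 1)(g₁(i) − g₂(i)) if and only if f minimizes the weighted misclassification loss Σᵢ 1(sgn(g₁(i) − g₂(i)) · f(i) < 0)|g₁(i) − g₂(i)|. -/
open Finset

theorem Real.sign_eq_one_iff_pos (x : ℝ) : Real.sign x = 1 ↔ 0 < x := by
  rcases lt_trichotomy x 0 with h | rfl | h
  · rw [Real.sign_of_neg h]
    constructor <;> intro <;> linarith
  · simp
  · simp [Real.sign_of_pos h, h]

/-- Gain from selecting positive scores and weighted misclassification loss add up to the
positive part of the weight, whatever the nonzero score. -/
theorem weighted_loss_add_gain (d : ℝ) {x : ℝ} (hx : x ≠ 0) :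
    (if Real.sign d * x < 0 then (1 : ℝ) else 0) * |d| + (if 0 < x then (1 : ℝ) else 0) * d
      = max d 0 := by
  rcases lt_trichotomy d 0 with hd | rfl | hd
  · rcases hx.lt_or_gt with h | h
    · simp [Real.sign_of_neg hd, h.not_gt, hd.le]
    · simp [Real.sign_of_neg hd, h, hd.le, abs_of_neg hd]
  · simp
  · rcases hx.lt_or_gt with h | h
    · simp [Real.sign_of_pos hd, h, h.not_gt, hd.le, abs_of_pos hd]
    · simp [Real.sign_of_pos hd, h, h.not_gt, hd.le]

theorem sum_weighted_loss_add_sum_gain {ι : Type*} [Fintype ι] (d : ι → ℝ) {f : ι → ℝ}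
    (hf : ∀ i, f i ≠ 0) :
    ∑ i, (if Real.sign (d i) * f i < 0 then (1 : ℝ) else 0) * |d i|
      + ∑ i, (if 0 < f i then (1 : ℝ) else 0) * d i = ∑ i, max (d i) 0 := by
  rw [← Finset.sum_add_distrib]
  exact Finset.sum_congr rfl fun i _ => weighted_loss_add_gain (d i) (hf i)

theorem sum_gain_ge_iff_sum_weighted_loss_le {ι : Type*} [Fintype ι] (d : ι → ℝ)
    {f h : ι → ℝ} (hf : ∀ i, f i ≠ 0) (hh : ∀ i, h i ≠ 0) :
    (∑ i, (if 0 < f i then (1 : ℝ) else 0) * d i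
        ≥ ∑ i, (if 0 < h i then (1 : ℝ) else 0) * d i) ↔
      ∑ i, (if Real.sign (d i) * f i < 0 then (1 : ℝ) else 0) * |d i|
        ≤ ∑ i, (if Real.sign (d i) * h i < 0 then (1 : ℝ) else 0) * |d i| := by
  have e₁ := sum_weighted_loss_add_sum_gain d hf
  have e₂ := sum_weighted_loss_add_sum_gain d hh
  constructor <;> intro <;> linarith

/-- Proposition 2: for nowhere-zero score functions `f, f'`, the empirical objective of
`f` is at least that of `f'` iff the weighted misclassification loss of `f` (with label
`sgn(g₁(i) − g₂(i))` and weight `|g₁(i) − g₂(i)|`) is at most that of `f'`.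
Consequently, among nowhere-zero score functions, `f` maximizes the empirical objective
`Σᵢ 1(sgn(f(i)) = 1)·(g₁(i) − g₂(i))` iff it minimizes the weighted loss. -/
theorem rise_classification_equivalence
    (n : ℕ) (hn : 0 < n) (g₁ g₂ : Fin n → ℝ) (f f' : Fin n → ℝ)
    (hf : ∀ i, f i ≠ 0) (hf' : ∀ i, f' i ≠ 0) :
    ((∑ i, (if 0 < f i then (1 : ℝ) else 0) * (g₁ i - g₂ i)
        ≥ ∑ i, (if 0 < f' i then (1 : ℝ) else 0) * (g₁ i - g₂ i)) ↔
      (∑ i, (if Real.sign (g₁ i - g₂ i) * f i < 0 then (1 : ℝ) else 0) * |g₁ i - g₂ i|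
        ≤ ∑ i, (if Real.sign (g₁ i - g₂ i) * f' i < 0 then (1 : ℝ) else 0)
            * |g₁ i - g₂ i|)) ∧
    ((∀ h : Fin n → ℝ, (∀ i, h i ≠ 0) →
        ∑ i, (if Real.sign (f i) = 1 then (1 : ℝ) else 0) * (g₁ i - g₂ i)
          ≥ ∑ i, (if Real.sign (h i) = 1 then (1 : ℝ) else 0) * (g₁ i - g₂ i)) ↔
      (∀ h : Fin n → ℝ, (∀ i, h i ≠ 0) →
        ∑ i, (if Real.sign (g₁ i - g₂ i) * f i < 0 then (1 : ℝ) else 0) * |g₁ i - g₂ i|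
          ≤ ∑ i, (if Real.sign (g₁ i - g₂ i) * h i < 0 then (1 : ℝ) else 0)
              * |g₁ i - g₂ i|)) := by
  simp only [Real.sign_eq_one_iff_pos]
  exact ⟨sum_gain_ge_iff_sum_weighted_loss_le (fun i => g₁ i - g₂ i) hf hf',
    forall₂_congr fun _ hh =>
      sum_gain_ge_iff_sum_weighted_loss_le (fun i => g₁ i - g₂ i) hf hh⟩
end

section
/- Let (X, 𝒜, μ) be a probability space, let 𝕊 be a nonempty finite set, and let m : X × 𝕊 × {false, true} → ℝ be such that for each s ∈ 𝕊 and a ∈ {false, true} the function x ↦ m(x, s, a) is measurable and integrable. For a ∈ {false, true} define h_a(x) = min_{s ∈ 𝕊} m(x, s, a), and define the decision rule d*(x) = true if h_true(x) ≥ h_false(x) and d*(x) = false otherwise. Then for every measurable decision rule d : X → {false, true}, ∫ min_{s ∈ 𝕊} m(x, s, d*(x)) dμ(x) ≥ ∫ min_{s ∈ 𝕊} m(x, s, d(x)) dμ(x). -/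
open MeasureTheory

theorem MeasureTheory.Integrable.finset_inf' {X ι : Type*} [MeasurableSpace X] {μ : Measure X}
    {s : Finset ι} (hs : s.Nonempty) {f : X → ι → ℝ}
    (hf : ∀ i ∈ s, Integrable (fun x => f x i) μ) :
    Integrable (fun x => s.inf' hs (f x)) μ := by
  have h : Integrable (s.inf' hs fun i x => f x i) μ :=
    Finset.inf'_induction (p := fun g : X → ℝ => Integrable g μ) hs _
      (fun _ h₁ _ h₂ => h₁.inf h₂) hf
  convert h using 2 with x
  rw [Finset.inf'_apply]

theorem MeasureTheory.Integrable.bool_select {X : Type*} [MeasurableSpace X] {μ : Measure X}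
    {g : X → Bool → ℝ} (hg : ∀ a, Integrable (fun x => g x a) μ)
    {d : X → Bool} (hd : Measurable d) :
    Integrable (fun x => g x (d x)) μ := by
  classical
  have h := Integrable.piecewise (hd (measurableSet_singleton true))
    (hg true).integrableOn (hg false).integrableOn
  refine h.congr (.of_forall fun x => ?_)
  cases hx : d x <;> simp [Set.piecewise, hx]

/-- Discrete sensitive variable case: with `m x s a = E(Y | X = x, S = s, A = a)` and
`hₐ(x) = min_{s ∈ 𝕊} m x s a`, the rule `d*(x) = true iff h_true(x) ≥ h_false(x)`
maximizes the infimum objective `∫ min_{s ∈ 𝕊} m x s (d x) dμ` over all measurable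
decision rules `d`. -/
theorem rise_infimum_rule_optimal
    {X : Type*} [MeasurableSpace X] (μ : Measure X) [IsProbabilityMeasure μ]
    {𝕊 : Type*} [Fintype 𝕊] [Nonempty 𝕊]
    (m : X → 𝕊 → Bool → ℝ)
    (hmeas : ∀ (s : 𝕊) (a : Bool), Measurable fun x => m x s a)
    (hint : ∀ (s : 𝕊) (a : Bool), Integrable (fun x => m x s a) μ)
    (d : X → Bool) (hd : Measurable d) :
    ∫ x, (Finset.univ.inf' Finset.univ_nonempty fun s =>
        m x s (if (Finset.univ.inf' Finset.univ_nonempty fun s => m x s false)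
                  ≤ (Finset.univ.inf' Finset.univ_nonempty fun s => m x s true)
               then true else false)) ∂μ
      ≥ ∫ x, (Finset.univ.inf' Finset.univ_nonempty fun s => m x s (d x)) ∂μ := by
  have hinf (a : Bool) :
      Integrable (fun x => Finset.univ.inf' Finset.univ_nonempty fun s => m x s a) μ :=
    Integrable.finset_inf' _ fun s _ => hint s a
  have hmax (x : X) :
      (Finset.univ.inf' Finset.univ_nonempty fun s =>
        m x s (if (Finset.univ.inf' Finset.univ_nonempty fun s => m x s false)
                  ≤ (Finset.univ.inf' Finset.univ_nonempty fun s => m x s true)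
               then true else false))
        = max (Finset.univ.inf' Finset.univ_nonempty fun s => m x s false)
            (Finset.univ.inf' Finset.univ_nonempty fun s => m x s true) := by
    split_ifs with h
    · exact (max_eq_right h).symm
    · exact (max_eq_left (not_le.mp h).le).symm
  simp only [hmax]
  refine integral_mono (Integrable.bool_select hinf hd) ((hinf false).sup (hinf true)) fun x => ?_
  dsimp only
  cases d x
  · exact le_max_left _ _
  · exact le_max_right _ _
end

section
/- There exist a nonempty finite probability space Ω with probability weights p : Ω → ℝ≥0 summing to 1, finite types 𝒳 and 𝒮, functions X : Ω → 𝒳, S : Ω → 𝒮, A : Ω → {false, true}, Y, Y₁, Y₀ : Ω → ℝ satisfying consistency (Y = Y₁ on {A = true} and Y = Y₀ on {A = false}), positivity (for every (x, s) with P(X = x, S = s) > 0, 0 < P(A = true | X = x, S = s) < 1), and unconfoundedness given (X, S) (for every (x, s) with P(X = x, S = s) > 0, every (y₁, y₀) ∈ ℝ² and a ∈ {false, true}: P(Y₁ = y₁, Y₀ = y₀, A = a | X = x, S = s) = P(Y₁ = y₁, Y₀ = y₀ | X = x, S = s) · P(A = a | X = x, S = s)), together with a decision rule d : 𝒳 →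 {false, true}, such that Σ_{(x,s) : P(X=x,S=s)>0} P(X = x, S = s) · E[Y | X = x, S = s, A = d(x)] ≠ Σ_{x : P(X=x)>0} P(X = x) · E[Y | X = x, A = d(x)], where E[Y | E] denotes E[Y · 1_E] / P(E) for an event E of positive probability. -/
open scoped Classical
open Finset

/-- Probability of the event `E` on a finite sample space with weights `p`. -/
noncomputable def finPr {Ω : Type*} [Fintype Ω] (p : Ω → NNReal) (E : Ω → Prop) : ℝ :=
  ∑ ω, if E ω then (p ω : ℝ) else 0

/-- Conditional expectation `E[Z | E] = E[Z · 1_E] / P(E)` on a finite sample space. -/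
noncomputable def finCExp {Ω : Type*} [Fintype Ω] (p : Ω → NNReal) (Z : Ω → ℝ)
    (E : Ω → Prop) : ℝ :=
  (∑ ω, if E ω then (p ω : ℝ) * Z ω else 0) / finPr p E

/-- A witness configuration for the bias of the naive approach: a finite nonempty
probability space with data `(X, S, A, Y, Y₁, Y₀)` satisfying consistency, positivity and
unconfoundedness given `(X, S)`, together with a decision rule `d` for which
`Σ_{(x,s): P(X=x,S=s)>0} P(X=x,S=s)·E[Y | X=x,S=s,A=d(x)]`
differs from `Σ_{x: P(X=x)>0} P(X=x)·E[Y | X=x,A=d(x)]`. -/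
def NaiveBiasWitness (Ω 𝒳 𝒮 : Type) [Fintype Ω] [Fintype 𝒳] [Fintype 𝒮]
    (p : Ω → NNReal) (X : Ω → 𝒳) (S : Ω → 𝒮) (A : Ω → Bool) (Y Y₁ Y₀ : Ω → ℝ)
    (d : 𝒳 → Bool) : Prop :=
  Nonempty Ω ∧
  (∑ ω, p ω) = 1 ∧
  -- consistency
  (∀ ω, Y ω = if A ω then Y₁ ω else Y₀ ω) ∧
  -- positivity
  (∀ (x : 𝒳) (s : 𝒮), 0 < finPr p (fun ω => X ω = x ∧ S ω = s) →
    0 < finPr p (fun ω => A ω = true ∧ X ω = x ∧ S ω = s)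
          / finPr p (fun ω => X ω = x ∧ S ω = s) ∧
    finPr p (fun ω => A ω = true ∧ X ω = x ∧ S ω = s)
          / finPr p (fun ω => X ω = x ∧ S ω = s) < 1) ∧
  -- unconfoundedness given (X, S)
  (∀ (x : 𝒳) (s : 𝒮), 0 < finPr p (fun ω => X ω = x ∧ S ω = s) →
    ∀ (y₁ y₀ : ℝ) (a : Bool),
      finPr p (fun ω => Y₁ ω = y₁ ∧ Y₀ ω = y₀ ∧ A ω = a ∧ X ω = x ∧ S ω = s)
          / finPr p (fun ω => X ω = x ∧ S ω = s)
        = (finPr p (fun ω => Y₁ ω = y₁ ∧ Y₀ ω = y₀ ∧ X ω = x ∧ S ω = s)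
            / finPr p (fun ω => X ω = x ∧ S ω = s))
          * (finPr p (fun ω => A ω = a ∧ X ω = x ∧ S ω = s)
            / finPr p (fun ω => X ω = x ∧ S ω = s))) ∧
  -- the adjusted and naive identification formulas disagree
  (∑ x : 𝒳, ∑ s : 𝒮,
      if 0 < finPr p (fun ω => X ω = x ∧ S ω = s) then
        finPr p (fun ω => X ω = x ∧ S ω = s)
          * finCExp p Y (fun ω => X ω = x ∧ S ω = s ∧ A ω = d x)
      else 0)
    ≠ (∑ x : 𝒳,
      if 0 < finPr p (fun ω => X ω = x) then
        finPr p (fun ω => X ω = x) * finCExp p Y (fun ω => X ω = x ∧ A ω = d x)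
      else 0)

/-- There exists a finite probability space satisfying consistency, positivity and
unconfoundedness given `(X, S)`, and a decision rule `d`, for which the value formula
adjusting for the sensitive variable `S` differs from the naive formula omitting `S`. -/
theorem rise_naive_approach_biased :
    ∃ (Ω 𝒳 𝒮 : Type) (instΩ : Fintype Ω) (inst𝒳 : Fintype 𝒳) (inst𝒮 : Fintype 𝒮)
      (p : Ω → NNReal) (X : Ω → 𝒳) (S : Ω → 𝒮) (A : Ω → Bool) (Y Y₁ Y₀ : Ω → ℝ)
      (d : 𝒳 → Bool),
      @NaiveBiasWitness Ω 𝒳 𝒮 instΩ inst𝒳 inst𝒮 p X S A Y Y₁ Y₀ d := by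
  refine ⟨Bool × Bool, Unit, Bool, inferInstance, inferInstance, inferInstance,
    fun ω => if ω.1 = ω.2 then 3 / 8 else 1 / 8, fun _ => (), Prod.fst, Prod.snd,
    fun ω => if ω.2 then (if ω.1 then 1 else 0) else 0, fun ω => if ω.1 then 1 else 0,
    fun _ => 0, fun _ => true, ⟨(true, true)⟩, ?_, ?_, ?_, ?_, ?_⟩
  · rw [← NNReal.coe_inj]
    simp [Fintype.sum_prod_type]
    norm_num
  · simp
  · rintro ⟨⟩ s -
    cases s <;> simp [finPr, Fintype.sum_prod_type] <;> norm_num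
  · rintro ⟨⟩ s - y₁ y₀ a
    cases s <;> cases a <;> simp [finPr, Fintype.sum_prod_type] <;> split_ifs <;> norm_num
  · simp [finPr, finCExp, Fintype.sum_prod_type]
    norm_num
end
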